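/- Optimal two-step group privacy bound for P-PRzCDP (appendix computation for J = 2): Let T be a record set, P : T → [0,∞) a policy function, and let M be a mechanism satisfying P-PRzCDP. Let D₀, D₁, D₂ be databases over T such that D₀ and D₁ differ in the record r₁, and D₁ and D₂ differ in the record r₂. Then for all α ∈ (1,∞), D_α(M(D₀)‖M(D₂)) ≤ α · ( P(r₁) + P(r₂) + 2·√(P(r₁)·P(r₂)) ). -/

import Mathlib

open MeasureTheory ProbabilityTheory
open scoped Classical NNReal

/-- Sényi divergence of order `α` between two measures. -/
noncomputable def renyiDiv {X : Type*} [MeasurableSpace X] (α : ℝ) (P Q : Measure X) : EReal :=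
  if P ≪ Q then (((α - 1)⁻¹ : ℝ) : EReal) * ENNReal.log (∫⁻ x, P.rnDeriv Q x ^ α ∂Q)
  else ⊤

/-- Databases `D` and `D'` differ in the single record `r`. -/
def Neighbors {T : Type*} (D D' : Multiset T) (r : T) : Prop :=
  D' = r ::ₘ D ∨ D = r ::ₘ D'

/-- Per-record zero-concentrated differential privacy with policy function `P`. -/
def PRzCDP {T Y : Type*} [MeasurableSpace Y] (M : Multiset T → Measure Y) (P : T → ℝ) : Prop :=
  ∀ α : ℝ, 1 < α → ∀ (D D' : Multiset T) (r : T), Neighbors D D' r →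
    renyiDiv α (M D) (M D') ≤ ((α * P r : ℝ) : EReal)

/-- Zero-concentrated differential privacy with privacy-loss parameter `ρ`. -/
def zCDP {T Y : Type*} [MeasurableSpace Y] (M : Multiset T → Measure Y) (ρ : ℝ) : Prop :=
  ∀ α : ℝ, 1 < α → ∀ (D D' : Multiset T) (r : T), Neighbors D D' r →
    renyiDiv α (M D) (M D') ≤ ((ρ * α : ℝ) : EReal)

theorem renyiDiv_le_coe_iff {X : Type*} [MeasurableSpace X] {α : ℝ} (hα : 1 < α)
    (P Q : Measure X) (c : ℝ) :
    renyiDiv α P Q ≤ (c : EReal) ↔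
      P ≪ Q ∧ ∫⁻ x, P.rnDeriv Q x ^ α ∂Q ≤ ENNReal.ofReal (Real.exp ((α - 1) * c)) := by
  unfold renyiDiv
  split_ifs with h
  · have hpos : (0 : EReal) < ((α - 1 : ℝ) : EReal) := by exact_mod_cast sub_pos.2 hα
    rw [EReal.coe_inv, ← EReal.div_eq_inv_mul,
      EReal.div_le_iff_le_mul hpos (EReal.coe_ne_top _), ← EReal.exp_le_exp_iff,
      ENNReal.exp_log, ← EReal.coe_mul, EReal.exp_coe]
    simp [h]
  · simp [h]

theorem lintegral_rnDeriv_rpow_le {X : Type*} [MeasurableSpace X] {α p q : ℝ} (hα : 1 < α)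
    (hpq : p.HolderConjugate q) (P Q S : Measure X) [SigmaFinite P] [SigmaFinite Q]
    [SigmaFinite S] (hPQ : P ≪ Q) (hQS : Q ≪ S) :
    ∫⁻ x, P.rnDeriv S x ^ α ∂S ≤
      (∫⁻ x, P.rnDeriv Q x ^ (p * α) ∂Q) ^ (1 / p) *
        (∫⁻ x, Q.rnDeriv S x ^ (q * (α - 1) + 1) ∂S) ^ (1 / q) := by
  have hp := hpq.pos
  have hq := hpq.symm.pos
  have hsum := hpq.inv_add_inv_eq_one
  have hf := Measure.measurable_rnDeriv P Q
  have hg := Measure.measurable_rnDeriv Q S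
  have hfactor : ∫⁻ x, P.rnDeriv S x ^ α ∂S = ∫⁻ x, ((fun x ↦ P.rnDeriv Q x ^ α *
      Q.rnDeriv S x ^ p⁻¹) * (fun x ↦ Q.rnDeriv S x ^ (α - 1 + q⁻¹))) x ∂S := by
    refine lintegral_congr_ae ?_
    filter_upwards [Measure.rnDeriv_mul_rnDeriv (κ := S) hPQ] with x hx
    rw [← hx, Pi.mul_apply, Pi.mul_apply, mul_assoc,
      ← ENNReal.rpow_add_of_nonneg _ _ (by positivity)
        (add_nonneg (sub_nonneg.2 hα.le) (by positivity)),
      ENNReal.mul_rpow_of_nonneg _ _ (by linarith)]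
    congr 2
    linarith
  have hleft : ∫⁻ x, (P.rnDeriv Q x ^ α * Q.rnDeriv S x ^ p⁻¹) ^ p ∂S =
      ∫⁻ x, P.rnDeriv Q x ^ (p * α) ∂Q := by
    rw [← lintegral_rnDeriv_mul hQS (hf.pow_const _).aemeasurable]
    refine lintegral_congr fun x ↦ ?_
    rw [ENNReal.mul_rpow_of_nonneg _ _ hp.le, ← ENNReal.rpow_mul, ← ENNReal.rpow_mul,
      inv_mul_cancel₀ hp.ne', ENNReal.rpow_one, mul_comm, mul_comm α]
  have hright : ∫⁻ x, (Q.rnDeriv S x ^ (α - 1 + q⁻¹)) ^ q ∂S =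
      ∫⁻ x, Q.rnDeriv S x ^ (q * (α - 1) + 1) ∂S := by
    refine lintegral_congr fun x ↦ ?_
    rw [← ENNReal.rpow_mul, add_mul, inv_mul_cancel₀ hq.ne', mul_comm q]
  rw [hfactor, ← hleft, ← hright]
  exact ENNReal.lintegral_mul_le_Lp_mul_Lq S hpq
    ((hf.pow_const _).mul (hg.pow_const _)).aemeasurable (hg.pow_const _).aemeasurable

/-- Weak triangle inequality for Sényi divergences. -/
theorem renyiDiv_le_of_holderConjugate {X : Type*} [MeasurableSpace X] {α p q : ℝ} (hα : 1 < α)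
    (hpq : p.HolderConjugate q) {P Q S : Measure X} [SigmaFinite P] [SigmaFinite Q]
    [SigmaFinite S] {A B : ℝ} (hA : renyiDiv (p * α) P Q ≤ (A : EReal))
    (hB : renyiDiv (q * (α - 1) + 1) Q S ≤ (B : EReal)) :
    renyiDiv α P S ≤ (((p * α - 1) / (p * (α - 1)) * A + B : ℝ) : EReal) := by
  have hp := hpq.pos
  have hq := hpq.symm.pos
  have hα' : 0 < α - 1 := sub_pos.2 hα
  rw [renyiDiv_le_coe_iff (by nlinarith [hpq.lt])] at hA
  rw [renyiDiv_le_coe_iff (by nlinarith [mul_pos hq hα'])] at hB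
  rw [renyiDiv_le_coe_iff hα]
  refine ⟨hA.1.trans hB.1, (lintegral_rnDeriv_rpow_le hα hpq P Q S hA.1 hB.1).trans ?_⟩
  calc _ ≤ ENNReal.ofReal (Real.exp ((p * α - 1) * A)) ^ (1 / p) *
        ENNReal.ofReal (Real.exp ((q * (α - 1) + 1 - 1) * B)) ^ (1 / q) := by
        gcongr
        exacts [hA.2, hB.2]
    _ = _ := by
        rw [ENNReal.ofReal_rpow_of_pos (Real.exp_pos _), ENNReal.ofReal_rpow_of_pos (Real.exp_pos _),
          ← ENNReal.ofReal_mul (by positivity), ← Real.exp_mul, ← Real.exp_mul, ← Real.exp_add]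
        congr 2
        field_simp
        ring

theorem renyiDiv_le_of_forall_le_mul {X : Type*} [MeasurableSpace X] {P Q S : Measure X}
    [SigmaFinite P] [SigmaFinite Q] [SigmaFinite S] {a b : ℝ} (ha : 0 ≤ a) (hb : 0 ≤ b)
    (hPQ : ∀ α : ℝ, 1 < α → renyiDiv α P Q ≤ ((α * a : ℝ) : EReal))
    (hQS : ∀ α : ℝ, 1 < α → renyiDiv α Q S ≤ ((α * b : ℝ) : EReal)) {α : ℝ} (hα : 1 < α) :
    renyiDiv α P S ≤ ((α * (a + b + 2 * √(a * b)) : ℝ) : EReal) := by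
  have hα' : 0 < α - 1 := sub_pos.2 hα
  have key : ∀ t : ℝ, 0 < t → renyiDiv α P S ≤ ((α * (a + b + (a * t + b / t)) : ℝ) : EReal) := by
    intro t ht
    set p : ℝ := 1 + t * (α - 1) / α with hp
    have hp1 : 1 < p := lt_add_of_pos_right 1 (by positivity)
    have hpq : p.HolderConjugate (p / (p - 1)) := .conjExponent hp1
    have hq := hpq.symm.pos
    convert renyiDiv_le_of_holderConjugate hα hpq (hPQ (p * α) (by nlinarith))
      (hQS (p / (p - 1) * (α - 1) + 1) (by nlinarith [mul_pos hq hα'])) using 2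
    have hp0 : p ≠ 0 := by positivity
    have hpα : p * α = α + t * (α - 1) := by rw [hp]; field_simp
    have hdiv : p / (p - 1) = 1 + α / (t * (α - 1)) := by
      have h1 : p - 1 = t * (α - 1) / α := by rw [hp]; ring
      rw [h1, hp]; field_simp
      ring
    have hcoef : (p * α - 1) / (p * (α - 1)) * (p * α * a) = α * a * (1 + t) := by
      rw [show (p * α - 1) / (p * (α - 1)) * (p * α * a) = (p * α - 1) / (α - 1) * (α * a) by
        field_simp, hpα]
      field_simp
      ring
    rw [hcoef, hdiv]
    field_simp
    ring
  have hlim : Filter.Tendsto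
      (fun e : ℝ ↦ ((α * (a + b + 2 * (√(a + e) * √(b + e))) : ℝ) : EReal))
      (nhdsWithin 0 (Set.Ioi 0)) (nhds ((α * (a + b + 2 * √(a * b)) : ℝ) : EReal)) := by
    have hc : Continuous
        (fun e : ℝ ↦ ((α * (a + b + 2 * (√(a + e) * √(b + e))) : ℝ) : EReal)) :=
      continuous_coe_real_ereal.comp (by fun_prop)
    simpa [Real.sqrt_mul ha] using (hc.tendsto 0).mono_left nhdsWithin_le_nhds
  refine ge_of_tendsto hlim (eventually_nhdsWithin_of_forall fun e he ↦ ?_)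
  have he : 0 < e := he
  have hu : 0 < √(a + e) := by positivity
  have hv : 0 < √(b + e) := by positivity
  refine (key (√(b + e) / √(a + e)) (by positivity)).trans (EReal.coe_le_coe_iff.2 ?_)
  have h1 : a * (√(b + e) / √(a + e)) ≤ √(a + e) * √(b + e) := by
    rw [← mul_div_assoc, div_le_iff₀ hu]
    nlinarith [Real.sq_sqrt (add_nonneg ha he.le)]
  have h2 : b / (√(b + e) / √(a + e)) ≤ √(a + e) * √(b + e) := by
    rw [div_div_eq_mul_div, div_le_iff₀ hv]
    nlinarith [Real.sq_sqrt (add_nonneg hb he.le)]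
  gcongr
  linarith

/-- Optimal two-step group privacy bound for P-PRzCDP (J = 2). -/
theorem przcdp_two_step_group_privacy {T Y : Type*} [MeasurableSpace Y]
    (P : T → ℝ) (hP : ∀ r, 0 ≤ P r)
    (M : Multiset T → Measure Y) (hMprob : ∀ D, IsProbabilityMeasure (M D))
    (hM : PRzCDP M P)
    (D₀ D₁ D₂ : Multiset T) (r₁ r₂ : T)
    (h₁ : Neighbors D₀ D₁ r₁) (h₂ : Neighbors D₁ D₂ r₂) :
    ∀ α : ℝ, 1 < α →
      renyiDiv α (M D₀) (M D₂) ≤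
        ((α * (P r₁ + P r₂ + 2 * Real.sqrt (P r₁ * P r₂)) : ℝ) : EReal) := by
  exact fun α hα ↦ renyiDiv_le_of_forall_le_mul (hP r₁) (hP r₂)
    (fun β hβ ↦ hM β hβ D₀ D₁ r₁ h₁) (fun β hβ ↦ hM β hβ D₁ D₂ r₂ h₂) hα
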